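/- arXiv:0903.2797 — 4 statements merged into one kernel-verified Lean document; each statement's English description precedes it below -/
import Mathlib

section
/- Let R be a commutative Noetherian local integral domain whose Krull dimension is at most 2. If S is an infinite set of prime ideals of R, each of height one, then the intersection ⋂_{𝔭 ∈ S} 𝔭 is the zero ideal. -/
/-- In a domain, a prime of height one is minimal over every non-zero ideal it contains. -/
theorem PrimeSpectrum.asIdeal_mem_minimalPrimes_of_height_eq_one {R : Type*} [CommRing R]
    [IsDomain R] {p : PrimeSpectrum R} (hp : Order.height p = 1) {I : Ideal R} (hI : I ≠ ⊥)
    (hIp : I ≤ p.asIdeal) : p.asIdeal ∈ I.minimalPrimes := by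
  refine ⟨⟨p.isPrime, hIp⟩, fun q hq hqp ↦ ?_⟩
  by_contra hpq
  let q' : PrimeSpectrum R := ⟨q, hq.1⟩
  have hlt : q' < p := lt_of_le_not_ge hqp hpq
  have hheight : Order.height q' < 1 :=
    hp ▸ Order.height_strictMono hlt (lt_of_le_of_lt (hp ▸ Order.height_mono hlt.le) (by simp))
  have hmin : IsMin q' := Order.height_eq_zero.mp (Order.lt_one_iff.mp hheight)
  have hbot : q ≤ ⊥ := hmin (b := ⟨⊥, Ideal.isPrime_bot⟩) (bot_le (a := q))
  exact hI (le_bot_iff.mp (hq.2.trans hbot))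

/-- key claim in the proof of Proposition 9.4. Let `R` be a commutative
Noetherian local integral domain of Krull dimension at most 2. If `S` is an infinite set of
prime ideals of `R`, each of height one, then `⋂_{𝔭 ∈ S} 𝔭 = 0`. -/
theorem iInf_of_infinite_height_one_primes
    (R : Type*) [CommRing R] [IsDomain R] [IsNoetherianRing R] [IsLocalRing R]
    (hdim : ringKrullDim R ≤ 2)
    (S : Set (PrimeSpectrum R)) (hS : S.Infinite)
    (hht : ∀ p ∈ S, Order.height p = 1) :
    (⨅ p ∈ S, p.asIdeal) = ⊥ := by
  by_contra hne
  refine hS (Set.Finite.of_finite_image ?_ (f := PrimeSpectrum.asIdeal)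
    fun p _ q _ h ↦ PrimeSpectrum.ext h)
  refine (Ideal.finite_minimalPrimes_of_isNoetherianRing R (⨅ p ∈ S, p.asIdeal)).subset ?_
  rintro _ ⟨p, hp, rfl⟩
  exact PrimeSpectrum.asIdeal_mem_minimalPrimes_of_height_eq_one (hht p hp) hne (iInf₂_le p hp)
end

section
/- Let K and B be finite-dimensional ℚ-algebras, let 𝒪 ⊆ K and R ⊆ B be subrings that are finitely generated as ℤ-modules and whose ℚ-spans are all of K and B respectively, and let f : K → B be an injective homomorphism of ℚ-algebras. For each prime number p let f_p : K ⊗_ℚ ℚ_p → B ⊗_ℚ ℚ_p denote the ℚ_p-algebra map induced by f, and let 𝒪_p (respectively R_p) denote the ℤ_p-submodule of K ⊗_ℚ ℚ_p (respectively B ⊗_ℚ ℚ_p) generated by the image of 𝒪 (respectively R). Then f⁻¹(R) = 𝒪 if and only if f_p⁻¹(R_p) = 𝒪_p for every prime p. -/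
open scoped TensorProduct

section Localization

variable {V : Type*} [AddCommGroup V] [Module ℚ V]

/-- The `ℤ_p`-submodule of `ℚ_p ⊗ V` generated by the image of a subgroup `L` of `V`. -/
noncomputable def AddSubgroup.padicSpan (L : AddSubgroup V) (p : ℕ) [Fact p.Prime] :
    Submodule ℤ_[p] (ℚ_[p] ⊗[ℚ] V) :=
  Submodule.span ℤ_[p] ((fun v => (1 : ℚ_[p]) ⊗ₜ[ℚ] v) '' (L : Set V))

namespace AddSubgroup

variable (L : AddSubgroup V)

theorem tmul_mem_padicSpan {p : ℕ} [Fact p.Prime] {a : ℚ_[p]} (ha : ‖a‖ ≤ 1) {v : V}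
    (hv : v ∈ L) : a ⊗ₜ[ℚ] v ∈ L.padicSpan p := by
  have h : a ⊗ₜ[ℚ] v = (show ℤ_[p] from ⟨a, ha⟩) • ((1 : ℚ_[p]) ⊗ₜ[ℚ] v) := by
    rw [TensorProduct.smul_tmul', Algebra.smul_def, mul_one]
    rfl
  rw [h]
  exact Submodule.smul_mem _ _ (Submodule.subset_span ⟨v, hv, rfl⟩)

theorem exists_sub_mem_padicSpan (hL : Submodule.span ℚ (L : Set V) = ⊤) (p : ℕ)
    [Fact p.Prime] (x : ℚ_[p] ⊗[ℚ] V) :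
    ∃ v : V, x - 1 ⊗ₜ[ℚ] v ∈ L.padicSpan p := by
  induction x using TensorProduct.induction_on with
  | zero => exact ⟨0, by simp⟩
  | add x y hx hy =>
    obtain ⟨v, hv⟩ := hx
    obtain ⟨w, hw⟩ := hy
    refine ⟨v + w, ?_⟩
    rw [TensorProduct.tmul_add, add_sub_add_comm]
    exact add_mem hv hw
  | tmul a w =>
    have hw : w ∈ Submodule.span ℚ (L : Set V) := hL ▸ Submodule.mem_top
    induction hw using Submodule.span_induction generalizing a with
    | zero => exact ⟨0, by simp⟩
    | add x y _ _ hx hy =>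
      obtain ⟨v, hv⟩ := hx a
      obtain ⟨w, hw⟩ := hy a
      refine ⟨v + w, ?_⟩
      rw [TensorProduct.tmul_add, TensorProduct.tmul_add, add_sub_add_comm]
      exact add_mem hv hw
    | smul q x _ hx =>
      rw [← TensorProduct.smul_tmul]
      exact hx _
    | mem x hx =>
      obtain ⟨r, hr⟩ := Padic.rat_dense p a one_pos
      refine ⟨r • x, ?_⟩
      rw [← TensorProduct.smul_tmul, ← TensorProduct.sub_tmul, Rat.smul_one_eq_cast]
      exact L.tmul_mem_padicSpan hr.le hx

theorem one_tmul_mem_padicSpan_of_nsmul_mem {p : ℕ} [hp : Fact p.Prime] {v : V} {n : ℕ}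
    (hn : p.Coprime n) (hv : n • v ∈ L) : (1 : ℚ_[p]) ⊗ₜ[ℚ] v ∈ L.padicSpan p := by
  have hn0 : (n : ℚ_[p]) ≠ 0 := by
    rintro h
    rw [Nat.cast_eq_zero] at h
    exact hp.out.one_lt.ne' (by simpa [h] using hn)
  have h : (1 : ℚ_[p]) ⊗ₜ[ℚ] v = (n : ℚ_[p])⁻¹ ⊗ₜ[ℚ] (n • v) := by
    rw [TensorProduct.tmul_smul, TensorProduct.smul_tmul', nsmul_eq_mul, mul_inv_cancel₀ hn0]
  rw [h]
  refine L.tmul_mem_padicSpan ?_ hv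
  rw [norm_inv, Padic.norm_natCast_eq_one_iff.2 hn, inv_one]

theorem exists_nsmul_mem_of_one_tmul_mem_padicSpan [Module.Finite ℤ L]
    (hL : Submodule.span ℚ (L : Set V) = ⊤) {p : ℕ} [hp : Fact p.Prime] {v : V}
    (hv : (1 : ℚ_[p]) ⊗ₜ[ℚ] v ∈ L.padicSpan p) : ∃ n : ℕ, p.Coprime n ∧ n • v ∈ L := by
  classical
  have : Module.IsTorsionFree ℤ V := Module.IsTorsionFree.trans ℚ
  have : Module.IsTorsionFree ℤ L :=
    Subtype.val_injective.moduleIsTorsionFree _ fun _ _ => rfl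
  let c := Module.Free.chooseBasis ℤ L
  have hc : LinearIndependent ℚ (fun i => (c i : V)) :=
    (LinearIndependent.iff_fractionRing ℤ ℚ).1
      (c.linearIndependent.map' L.toIntSubmodule.subtype (Submodule.ker_subtype _))
  have hsum (x : L) : (x : V) = ∑ i, c.repr x i • (c i : V) :=
    (congrArg L.subtype (c.sum_repr x).symm).trans (map_sum L.subtype _ _)
  let b : Module.Basis _ ℚ V := Module.Basis.mk hc (by
    rw [← hL, Submodule.span_le]
    intro x hx
    have h := hsum ⟨x, hx⟩
    dsimp only at h
    rw [h, SetLike.mem_coe]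
    exact sum_mem fun i _ => zsmul_mem (Submodule.subset_span (Set.mem_range_self i)) _)
  have hb (i) : b i = c i := Module.Basis.mk_apply _ _ i
  have hrepr (x : L) (i) : b.repr x i = c.repr x i := by
    rw [hsum x]
    simp_rw [← hb, ← Int.cast_smul_eq_zsmul ℚ]
    rw [b.repr_sum_self]
  have hint (x) (hx : x ∈ L.padicSpan p) (i) :
      ‖(Algebra.TensorProduct.basis ℚ_[p] b).repr x i‖ ≤ 1 := by
    induction hx using Submodule.span_induction with
    | zero => simp
    | add x y _ _ hx hy =>
      rw [map_add, Finsupp.add_apply]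
      exact (IsUltrametricDist.norm_add_le_max _ _).trans (max_le hx hy)
    | smul a x _ hx =>
      rw [← algebraMap_smul ℚ_[p] a x, map_smul, Finsupp.smul_apply, smul_eq_mul, norm_mul]
      exact mul_le_one₀ a.2 (norm_nonneg _) hx
    | mem x hx =>
      obtain ⟨l, hl, rfl⟩ := hx
      simp only [Algebra.TensorProduct.basis_repr_tmul]
      simpa [hrepr ⟨l, hl⟩] using Padic.norm_int_le_one _
  have hden (i) : p.Coprime (b.repr v i).den := by
    have h := hint _ hv i
    simp only [Algebra.TensorProduct.basis_repr_tmul] at h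
    rw [← Padic.norm_natCast_eq_one_iff]
    exact PadicInt.isUnit_iff.1 (PadicInt.isUnit_den _ (by simpa using h))
  refine ⟨∏ i, (b.repr v i).den, Nat.Coprime.prod_right fun i _ => hden i, ?_⟩
  suffices h : ∀ i, (∏ j, (b.repr v j).den) • b.repr v i • b i ∈ L by
    have := sum_mem (fun i (_ : i ∈ Finset.univ) => h i)
    rwa [← Finset.smul_sum, b.sum_repr] at this
  intro i
  rw [← Finset.mul_prod_erase _ _ (Finset.mem_univ i), mul_comm, mul_smul, hb]
  refine nsmul_mem ?_ _
  rw [← Nat.cast_smul_eq_nsmul ℚ, smul_smul, mul_comm, Rat.mul_den_eq_num,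
    Int.cast_smul_eq_zsmul]
  exact zsmul_mem (c i).2 _

theorem mem_of_forall_exists_nsmul_mem {A : Type*} [AddCommGroup A] (L : AddSubgroup A) {v : A}
    (h : ∀ p : ℕ, p.Prime → ∃ n : ℕ, p.Coprime n ∧ n • v ∈ L) : v ∈ L := by
  let d := addOrderOf (QuotientAddGroup.mk v : A ⧸ L)
  have key (n : ℕ) : n • v ∈ L ↔ d ∣ n := by
    rw [addOrderOf_dvd_iff_nsmul_eq_zero, ← QuotientAddGroup.mk_nsmul,
      QuotientAddGroup.eq_zero_iff]
  rw [← one_nsmul v, key, Nat.dvd_one]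
  by_contra hd
  obtain ⟨p, hp, hpd⟩ := Nat.exists_prime_and_dvd hd
  obtain ⟨n, hn, hnv⟩ := h p hp
  exact (hp.coprime_iff_not_dvd.1 hn) (hpd.trans ((key n).1 hnv))

theorem mem_iff_forall_one_tmul_mem_padicSpan [Module.Finite ℤ L]
    (hL : Submodule.span ℚ (L : Set V) = ⊤) {v : V} :
    v ∈ L ↔ ∀ (p : ℕ) [Fact p.Prime], (1 : ℚ_[p]) ⊗ₜ[ℚ] v ∈ L.padicSpan p := by
  refine ⟨fun hv p _ => L.tmul_mem_padicSpan norm_one.le hv, fun h => ?_⟩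
  refine L.mem_of_forall_exists_nsmul_mem fun p hp => ?_
  have : Fact p.Prime := ⟨hp⟩
  exact L.exists_nsmul_mem_of_one_tmul_mem_padicSpan hL (h p)

theorem padicSpan_le_comap {W : Type*} [AddCommGroup W] [Module ℚ W] {L : AddSubgroup V}
    {M : AddSubgroup W} (f : V →ₗ[ℚ] W) (h : ∀ v ∈ L, f v ∈ M) (p : ℕ) [Fact p.Prime] :
    L.padicSpan p ≤ (M.padicSpan p).comap
      ((f.baseChange ℚ_[p]).restrictScalars ℤ_[p]) := by
  refine Submodule.span_le.2 ?_
  rintro _ ⟨v, hv, rfl⟩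
  exact M.tmul_mem_padicSpan norm_one.le (h v hv)

/-- A linear map between rational vector spaces pulls a lattice back to a given lattice if and
only if it does so after completion at every prime. -/
theorem preimage_eq_iff_forall_padicSpan {W : Type*} [AddCommGroup W] [Module ℚ W]
    (L : AddSubgroup V) (M : AddSubgroup W) [Module.Finite ℤ L] [Module.Finite ℤ M]
    (hL : Submodule.span ℚ (L : Set V) = ⊤) (hM : Submodule.span ℚ (M : Set W) = ⊤)
    (f : V →ₗ[ℚ] W) :
    f ⁻¹' (M : Set W) = L ↔ ∀ (p : ℕ) [Fact p.Prime],
      f.baseChange ℚ_[p] ⁻¹' (M.padicSpan p : Set (ℚ_[p] ⊗[ℚ] W)) = L.padicSpan p := by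
  refine ⟨fun h p _ => ?_, fun h => ?_⟩
  · have hLM := padicSpan_le_comap f (fun v hv => (Set.ext_iff.1 h v).2 hv) p
    refine Set.Subset.antisymm (fun x hx => ?_) hLM
    obtain ⟨v, hv⟩ := L.exists_sub_mem_padicSpan hL p x
    have hfv : (1 : ℚ_[p]) ⊗ₜ[ℚ] f v ∈ M.padicSpan p := by
      have := sub_mem (show f.baseChange ℚ_[p] x ∈ M.padicSpan p from hx) (hLM hv)
      simpa using this
    obtain ⟨n, hn, hnv⟩ := M.exists_nsmul_mem_of_one_tmul_mem_padicSpan hM hfv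
    rw [← map_nsmul] at hnv
    have := L.one_tmul_mem_padicSpan_of_nsmul_mem hn ((Set.ext_iff.1 h _).1 hnv)
    simpa using add_mem hv this
  · ext v
    rw [Set.mem_preimage, SetLike.mem_coe, SetLike.mem_coe,
      M.mem_iff_forall_one_tmul_mem_padicSpan hM, L.mem_iff_forall_one_tmul_mem_padicSpan hL]
    refine forall_congr' fun p => forall_congr' fun _ => ?_
    exact Set.ext_iff.1 (h p) (1 ⊗ₜ[ℚ] v)

end AddSubgroup

end Localization

/-- Lemma 4.1: optimality of an embedding is a local property. Let `K`,
`B` be finite-dimensional `ℚ`-algebras, `𝒪 ⊆ K` and `R ⊆ B` subrings finitely generated as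
`ℤ`-modules whose `ℚ`-spans are all of `K` and `B`, and `f : K → B` an injective
`ℚ`-algebra homomorphism. For a prime `p`, `f_p : ℚ_p ⊗_ℚ K → ℚ_p ⊗_ℚ B` is the induced
map and `𝒪_p` (resp. `R_p`) is the `ℤ_p`-submodule generated by the image of `𝒪`
(resp. `R`). Then `f⁻¹(R) = 𝒪` iff `f_p⁻¹(R_p) = 𝒪_p` for every prime `p`. -/
theorem optimal_embedding_is_local
    (K B : Type*) [Ring K] [Ring B] [Algebra ℚ K] [Algebra ℚ B]
    [FiniteDimensional ℚ K] [FiniteDimensional ℚ B]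
    (O : Subring K) (R : Subring B)
    (hO : Module.Finite ℤ O) (hR : Module.Finite ℤ R)
    (hOspan : Submodule.span ℚ (O : Set K) = ⊤)
    (hRspan : Submodule.span ℚ (R : Set B) = ⊤)
    (f : K →ₐ[ℚ] B) (hf : Function.Injective f) :
    (f ⁻¹' (R : Set B) = (O : Set K)) ↔
      ∀ (p : ℕ) [Fact p.Prime],
        (Algebra.TensorProduct.map (AlgHom.id ℚ ℚ_[p]) f) ⁻¹'
            ((Submodule.span ℤ_[p]
              ((Algebra.TensorProduct.includeRight : B →ₐ[ℚ] ℚ_[p] ⊗[ℚ] B) ''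
                (R : Set B)) : Submodule ℤ_[p] (ℚ_[p] ⊗[ℚ] B)) : Set (ℚ_[p] ⊗[ℚ] B)) =
          ((Submodule.span ℤ_[p]
            ((Algebra.TensorProduct.includeRight : K →ₐ[ℚ] ℚ_[p] ⊗[ℚ] K) ''
              (O : Set K)) : Submodule ℤ_[p] (ℚ_[p] ⊗[ℚ] K)) : Set (ℚ_[p] ⊗[ℚ] K)) := by
  have : Module.Finite ℤ O.toAddSubgroup := hO
  have : Module.Finite ℤ R.toAddSubgroup := hR
  exact AddSubgroup.preimage_eq_iff_forall_padicSpan O.toAddSubgroup R.toAddSubgroup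
    hOspan hRspan f.toLinearMap
end

section
/- Let p be a prime number and h, n ≥ 0 integers. Define the map ψ : ℚ_p × ℚ_p → M₂(ℚ_p) by sending (α, β) to the 2×2 matrix with first row (α, 0) and second row (p^{-h}(α − β), β). Then ψ is an injective ℚ_p-algebra homomorphism, and the preimage ψ⁻¹(E_n) of the set E_n := {A ∈ M₂(ℤ_p) : the (2,1) entry of A lies in pⁿℤ_p} equals {(α, β) : α ∈ ℤ_p, β ∈ ℤ_p, α − β ∈ p^{h+n}ℤ_p}. -/
/-- split-case optimality of the local embedding `ψ_p^{(c)}`, §4.1 /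
Lemma 4.3. Let `p` be a prime and `h, n ≥ 0`. The map
`ψ(α, β) = !![α, 0; p^{-h}(α−β), β]` is an injective `ℚ_p`-algebra homomorphism
`ℚ_p × ℚ_p → M₂(ℚ_p)`, and the preimage under `ψ` of
`E_n = {A ∈ M₂(ℤ_p) : (2,1)-entry of A lies in pⁿℤ_p}` is
`{(α, β) : α ∈ ℤ_p, β ∈ ℤ_p, α − β ∈ p^{h+n}ℤ_p}`. -/
theorem split_local_embedding_optimal
    (p : ℕ) [Fact p.Prime] (h n : ℕ)
    (ψ : ℚ_[p] × ℚ_[p] → Matrix (Fin 2) (Fin 2) ℚ_[p])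
    (hψ : ∀ x : ℚ_[p] × ℚ_[p],
      ψ x = !![x.1, 0; (p : ℚ_[p]) ^ (-(h : ℤ)) * (x.1 - x.2), x.2]) :
    (∃ Ψ : (ℚ_[p] × ℚ_[p]) →ₐ[ℚ_[p]] Matrix (Fin 2) (Fin 2) ℚ_[p],
        ⇑Ψ = ψ ∧ Function.Injective Ψ) ∧
    ψ ⁻¹' {A : Matrix (Fin 2) (Fin 2) ℚ_[p] |
        (∀ i j, ∃ y : ℤ_[p], (y : ℚ_[p]) = A i j) ∧
        ∃ y : ℤ_[p], A 1 0 = (p : ℚ_[p]) ^ n * (y : ℚ_[p])} =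
      {x : ℚ_[p] × ℚ_[p] |
        (∃ a : ℤ_[p], (a : ℚ_[p]) = x.1) ∧ (∃ b : ℤ_[p], (b : ℚ_[p]) = x.2) ∧
        ∃ c : ℤ_[p], x.1 - x.2 = (p : ℚ_[p]) ^ (h + n) * (c : ℚ_[p])} := by
  have hp : (p : ℚ_[p]) ≠ 0 := Nat.cast_ne_zero.mpr (Fact.out : p.Prime).ne_zero
  refine ⟨⟨AlgHom.ofLinearMap
    { toFun := ψ
      map_add' := fun x y => ?_
      map_smul' := fun r x => ?_ } ?_ ?_, rfl, ?_⟩, ?_⟩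
  · ext i j
    fin_cases i <;> fin_cases j <;> simp [hψ]
    ring
  · ext i j
    fin_cases i <;> fin_cases j <;> simp [hψ]
    ring
  · ext i j
    fin_cases i <;> fin_cases j <;> simp [hψ]
  · intro x y
    ext i j
    fin_cases i <;> fin_cases j <;> simp [hψ, Matrix.mul_apply, Fin.sum_univ_two]
    ring
  · intro x y hxy
    have hxy' : ψ x = ψ y := hxy
    rw [hψ, hψ] at hxy'
    exact Prod.ext (by simpa using congrFun (congrFun hxy' 0) 0)
      (by simpa using congrFun (congrFun hxy' 1) 1)
  · have key : ∀ d y : ℚ_[p], (p : ℚ_[p]) ^ (-(h : ℤ)) * d = (p : ℚ_[p]) ^ n * y ↔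
        d = (p : ℚ_[p]) ^ (h + n) * y := fun d y => by
      rw [zpow_neg, zpow_natCast, inv_mul_eq_iff_eq_mul₀ (pow_ne_zero h hp), pow_add, mul_assoc]
    ext x
    simp only [Set.mem_preimage, Set.mem_ofPred_eq, hψ]
    constructor
    · rintro ⟨hint, y, hy⟩
      exact ⟨by simpa using hint 0 0, by simpa using hint 1 1, y, (key _ _).mp (by simpa using hy)⟩
    · rintro ⟨ha, hb, c, hc⟩
      have hc' := (key _ _).mpr hc
      refine ⟨fun i j => ?_, c, by simpa using hc'⟩
      fin_cases i <;> fin_cases j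
      · simpa using ha
      · exact ⟨0, by simp⟩
      · exact ⟨(p : ℤ_[p]) ^ n * c, by simpa using hc'.symm⟩
      · simpa using hb
end

section
/- Let p be a prime number, D a positive integer not divisible by p, and h, n ≥ 0 integers. In M₂(ℚ_p) the matrix J with first row (0, −Dp^h) and second row (p^{-h}, 0) satisfies J² = −D·Id, so there is a (unique) ℚ_p-algebra homomorphism ψ : ℚ_p[X]/(X² + D) → M₂(ℚ_p) sending the class of X to J; explicitly ψ(α + βX) is the matrix with rows (α, −Dβp^h) and (p^{-h}β, α). Then ψ is injective and ψ⁻¹(E_n) = {α + βX : α ∈ ℤ_p, β ∈ p^{h+n}ℤ_p}, where E_n := {A ∈ M₂(ℤ_p) : the (2,1) entry of A lies in pⁿℤ_p}. -/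
open Polynomial

/-- Every element of `R[X]/(X² + d)` is of the form `α + βX`. -/
theorem AdjoinRoot.exists_eq_of_add_of_mul_root {R : Type*} [CommRing R] [Nontrivial R] (d : R)
    (z : AdjoinRoot (X ^ 2 + C d)) :
    ∃ α β : R, z = AdjoinRoot.of (X ^ 2 + C d) α +
      AdjoinRoot.of (X ^ 2 + C d) β * AdjoinRoot.root (X ^ 2 + C d) := by
  have hm : (X ^ 2 + C d).Monic := monic_X_pow_add_C d two_ne_zero
  obtain ⟨q, rfl⟩ := AdjoinRoot.mk_surjective z
  have hlt : (q %ₘ (X ^ 2 + C d)).natDegree < (X ^ 2 + C d).natDegree :=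
    natDegree_modByMonic_lt q hm fun h1 => by
      simpa [h1] using natDegree_X_pow_add_C (n := 2) (r := d)
  rw [natDegree_X_pow_add_C] at hlt
  obtain ⟨b, a, hab⟩ := exists_eq_X_add_C_of_natDegree_le_one (Nat.le_of_lt_succ hlt)
  refine ⟨a, b, ?_⟩
  rw [← modByMonic_add_div q (X ^ 2 + C d), hab]
  simp [AdjoinRoot.mk_C, AdjoinRoot.mk_X, add_comm]

/-- inert-case optimality of the local embedding `ψ_p^{(c)}`, §4.1 /
Lemma 4.3. Let `p` be a prime, `D` a positive integer prime to `p`, and `h, n ≥ 0`. The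
matrix `J = !![0, −Dp^h; p^{−h}, 0]` satisfies `J² = −D·1`, so there is a unique
`ℚ_p`-algebra homomorphism `ψ : ℚ_p[X]/(X² + D) → M₂(ℚ_p)` sending (the class of) `X` to
`J`; explicitly `ψ(α + βX) = !![α, −Dβp^h; p^{−h}β, α]`. Moreover `ψ` is injective and
`ψ⁻¹(E_n) = {α + βX : α ∈ ℤ_p, β ∈ p^{h+n}ℤ_p}`, where
`E_n = {A ∈ M₂(ℤ_p) : (2,1)-entry ∈ pⁿℤ_p}`. -/
theorem inert_local_embedding_optimal
    (p : ℕ) [Fact p.Prime] (D : ℕ) (hD : 0 < D) (hpD : ¬ (p : ℤ) ∣ (D : ℤ))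
    (h n : ℕ)
    (J : Matrix (Fin 2) (Fin 2) ℚ_[p])
    (hJ : J = !![0, -(D : ℚ_[p]) * (p : ℚ_[p]) ^ (h : ℕ);
                 (p : ℚ_[p]) ^ (-(h : ℤ)), 0]) :
    J ^ 2 = (-(D : ℚ_[p])) • (1 : Matrix (Fin 2) (Fin 2) ℚ_[p]) ∧
    ∃! ψ : AdjoinRoot (X ^ 2 + C (D : ℚ_[p])) →ₐ[ℚ_[p]] Matrix (Fin 2) (Fin 2) ℚ_[p],
      ψ (AdjoinRoot.root (X ^ 2 + C (D : ℚ_[p]))) = J ∧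
      (∀ α β : ℚ_[p],
        ψ (AdjoinRoot.of (X ^ 2 + C (D : ℚ_[p])) α +
            AdjoinRoot.of (X ^ 2 + C (D : ℚ_[p])) β *
              AdjoinRoot.root (X ^ 2 + C (D : ℚ_[p]))) =
          !![α, -(D : ℚ_[p]) * β * (p : ℚ_[p]) ^ (h : ℕ);
             (p : ℚ_[p]) ^ (-(h : ℤ)) * β, α]) ∧
      Function.Injective ψ ∧
      ψ ⁻¹' {A : Matrix (Fin 2) (Fin 2) ℚ_[p] |
          (∀ i j, ∃ y : ℤ_[p], (y : ℚ_[p]) = A i j) ∧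
          ∃ y : ℤ_[p], A 1 0 = (p : ℚ_[p]) ^ n * (y : ℚ_[p])} =
        {z : AdjoinRoot (X ^ 2 + C (D : ℚ_[p])) |
          ∃ (a b : ℤ_[p]), z =
            AdjoinRoot.of (X ^ 2 + C (D : ℚ_[p])) (a : ℚ_[p]) +
            AdjoinRoot.of (X ^ 2 + C (D : ℚ_[p])) ((p : ℚ_[p]) ^ (h + n) * (b : ℚ_[p])) *
              AdjoinRoot.root (X ^ 2 + C (D : ℚ_[p]))} := by
  have hp : (p : ℚ_[p]) ≠ 0 := Nat.cast_ne_zero.2 (Fact.out : p.Prime).ne_zero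
  have hJ2 : J ^ 2 = (-(D : ℚ_[p])) • (1 : Matrix (Fin 2) (Fin 2) ℚ_[p]) := by
    subst hJ
    ext i j
    fin_cases i <;> fin_cases j <;> simp [pow_two, Matrix.mul_apply, hp]
    field_simp
  have hroot : aeval J (X ^ 2 + C (D : ℚ_[p])) = 0 := by
    simp [hJ2, Algebra.algebraMap_eq_smul_one, -map_natCast]
  let ψ : AdjoinRoot (X ^ 2 + C (D : ℚ_[p])) →ₐ[ℚ_[p]] Matrix (Fin 2) (Fin 2) ℚ_[p] :=
    Ideal.Quotient.liftₐ (Ideal.span {X ^ 2 + C (D : ℚ_[p])}) (aeval J) fun a ha => by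
      obtain ⟨c, rfl⟩ := Ideal.mem_span_singleton.1 ha
      rw [map_mul, hroot, zero_mul]
  have hψ : ψ (AdjoinRoot.root (X ^ 2 + C (D : ℚ_[p]))) = J := aeval_X J
  have hform : ∀ α β : ℚ_[p],
      ψ (AdjoinRoot.of (X ^ 2 + C (D : ℚ_[p])) α +
          AdjoinRoot.of (X ^ 2 + C (D : ℚ_[p])) β *
            AdjoinRoot.root (X ^ 2 + C (D : ℚ_[p]))) =
        !![α, -(D : ℚ_[p]) * β * (p : ℚ_[p]) ^ (h : ℕ);
           (p : ℚ_[p]) ^ (-(h : ℤ)) * β, α] := by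
    intro α β
    rw [map_add, map_mul, hψ, ← AdjoinRoot.algebraMap_eq, AlgHom.commutes, AlgHom.commutes, hJ,
      Algebra.algebraMap_eq_smul_one, Algebra.algebraMap_eq_smul_one]
    ext i j
    fin_cases i <;> fin_cases j <;> simp <;> ring
  refine ⟨hJ2, ψ, ⟨hψ, hform, ?_, ?_⟩, fun φ hφ => AdjoinRoot.algHom_ext (hφ.1.trans hψ.symm)⟩
  · refine (injective_iff_map_eq_zero ψ).2 fun z hz => ?_
    obtain ⟨α, β, rfl⟩ := AdjoinRoot.exists_eq_of_add_of_mul_root _ z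
    rw [hform] at hz
    have hα : α = 0 := congrFun (congrFun hz 0) 0
    have hβ : (p : ℚ_[p]) ^ (-(h : ℤ)) * β = 0 := congrFun (congrFun hz 1) 0
    have hβ' : β = 0 := (mul_eq_zero.1 hβ).resolve_left (zpow_ne_zero _ hp)
    simp [hα, hβ']
  · ext z
    constructor
    · obtain ⟨α, β, rfl⟩ := AdjoinRoot.exists_eq_of_add_of_mul_root _ z
      rintro ⟨hint, y, hy⟩
      rw [hform] at hint hy
      obtain ⟨a, ha⟩ : ∃ a : ℤ_[p], (a : ℚ_[p]) = α := hint 0 0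
      have hy' : (p : ℚ_[p]) ^ (-(h : ℤ)) * β = (p : ℚ_[p]) ^ n * y := hy
      have hβ : β = (p : ℚ_[p]) ^ (h + n) * y := by
        rw [pow_add, mul_assoc, ← hy', zpow_neg, zpow_natCast,
          mul_inv_cancel_left₀ (pow_ne_zero _ hp)]
      exact ⟨a, y, by rw [ha, hβ]⟩
    · rintro ⟨a, b, rfl⟩
      have h10 : (p : ℚ_[p]) ^ (-(h : ℤ)) * ((p : ℚ_[p]) ^ (h + n) * b) =
          (p : ℚ_[p]) ^ n * b := by
        rw [pow_add, mul_assoc, zpow_neg, zpow_natCast, inv_mul_cancel_left₀ (pow_ne_zero _ hp)]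
      rw [Set.mem_preimage, hform, h10]
      refine ⟨fun i j => ?_, b, rfl⟩
      fin_cases i <;> fin_cases j
      · exact ⟨a, rfl⟩
      · exact ⟨-(D : ℤ_[p]) * ((p : ℤ_[p]) ^ (h + n) * b) * (p : ℤ_[p]) ^ h, by simp⟩
      · exact ⟨(p : ℤ_[p]) ^ n * b, by simp⟩
      · exact ⟨a, rfl⟩
end
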